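/- arXiv:2311.14681 — 2 statements merged into one kernel-verified Lean document; each statement's English description precedes it below -/
import Mathlib

section
/- Let f : X^n → ℝ be bounded, and let Ū^ℓ_f and L̄^ℓ_f be approximate upper and lower sensitivity bounding functions for f. Then for any neighboring datasets x, x' ∈ X^n and any t ∈ ℝ with inf_{z ∈ X^n} f(z) ≤ t ≤ sup_{z ∈ X^n} f(z), the approximate reflective inverse sensitivities satisfy |Ψ̄_f(x;t) − Ψ̄_f(x';t)| ≤ 1. -/
open scoped Classical

/-- Hamming distance between two datasets in `X^n`. -/
noncomputable def hdist {n : ℕ} {X : Type*} (x x' : Fin n → X) : ℕ :=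
  (Finset.univ.filter fun i => x i ≠ x' i).card

/-- The exact upper output bound `U^ℓ_f(x)` (for bounded `f`). -/
noncomputable def upperBd {n : ℕ} {X : Type*} (f : (Fin n → X) → ℝ)
    (x : Fin n → X) (ℓ : ℕ) : ℝ :=
  sSup (f '' {x' | hdist x x' ≤ ℓ})

/-- The exact lower output bound `L^ℓ_f(x)` (for bounded `f`). -/
noncomputable def lowerBd {n : ℕ} {X : Type*} (f : (Fin n → X) → ℝ)
    (x : Fin n → X) (ℓ : ℕ) : ℝ :=
  sInf (f '' {x' | hdist x x' ≤ ℓ})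

/-- The approximate inverse sensitivity
`len̄_f(x;t) = inf{ ℓ ∈ ℕ : L̄^ℓ_f(x) ≤ t ≤ Ū^ℓ_f(x) }`, valued in `ℕ ∪ {∞}`. -/
noncomputable def approxInvSens {n : ℕ} {X : Type*}
    (U L : ℕ → (Fin n → X) → ℝ) (x : Fin n → X) (t : ℝ) : ℕ∞ :=
  sInf ((fun ℓ : ℕ => (ℓ : ℕ∞)) '' {ℓ : ℕ | L ℓ x ≤ t ∧ t ≤ U ℓ x})

/-- The approximate reflective inverse sensitivity
`Ψ̄_f(x;t) = sgn(t − f(x)) · (len̄_f(x;t) − 1/2)`, where `sgn 0 = 0`. -/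
noncomputable def approxReflSens {n : ℕ} {X : Type*} (f : (Fin n → X) → ℝ)
    (U L : ℕ → (Fin n → X) → ℝ) (x : Fin n → X) (t : ℝ) : ℝ :=
  Real.sign (t - f x) * (((approxInvSens U L x t).toNat : ℝ) - 1 / 2)

theorem hdist_comm {n : ℕ} {X : Type*} (x y : Fin n → X) : hdist x y = hdist y x := by
  simp only [hdist, ne_comm]

theorem hdist_self {n : ℕ} {X : Type*} (x : Fin n → X) : hdist x x = 0 := by
  simp [hdist]

theorem hdist_le {n : ℕ} {X : Type*} (x y : Fin n → X) : hdist x y ≤ n :=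
  (Finset.card_le_univ _).trans_eq (Fintype.card_fin n)

theorem image_setOf_hdist_le_self {n : ℕ} {X : Type*} (f : (Fin n → X) → ℝ) (x : Fin n → X) :
    f '' {y | hdist x y ≤ n} = Set.range f := by
  simp [hdist_le]

theorem le_upperBd {n : ℕ} {X : Type*} {f : (Fin n → X) → ℝ} (hf : BddAbove (Set.range f))
    {x y : Fin n → X} {ℓ : ℕ} (h : hdist x y ≤ ℓ) : f y ≤ upperBd f x ℓ :=
  le_csSup (hf.mono (Set.image_subset_range _ _)) ⟨y, h, rfl⟩

theorem lowerBd_le {n : ℕ} {X : Type*} {f : (Fin n → X) → ℝ} (hf : BddBelow (Set.range f))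
    {x y : Fin n → X} {ℓ : ℕ} (h : hdist x y ≤ ℓ) : lowerBd f x ℓ ≤ f y :=
  csInf_le (hf.mono (Set.image_subset_range _ _)) ⟨y, h, rfl⟩

theorem approxInvSens_le {n : ℕ} {X : Type*} {U L : ℕ → (Fin n → X) → ℝ} {x : Fin n → X}
    {t : ℝ} {ℓ : ℕ} (hL : L ℓ x ≤ t) (hU : t ≤ U ℓ x) : approxInvSens U L x t ≤ ℓ :=
  sInf_le ⟨ℓ, ⟨hL, hU⟩, rfl⟩

theorem toNat_approxInvSens_le {n : ℕ} {X : Type*} {U L : ℕ → (Fin n → X) → ℝ} {x : Fin n → X}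
    {t : ℝ} {ℓ : ℕ} (hL : L ℓ x ≤ t) (hU : t ≤ U ℓ x) :
    (approxInvSens U L x t).toNat ≤ ℓ :=
  ENat.toNat_le_of_le_natCast (approxInvSens_le hL hU)

/-- The infimum defining the approximate inverse sensitivity is attained when it is finite. -/
theorem toNat_approxInvSens_mem {n : ℕ} {X : Type*} {U L : ℕ → (Fin n → X) → ℝ} {x : Fin n → X}
    {t : ℝ} {ℓ : ℕ} (hL : L ℓ x ≤ t) (hU : t ≤ U ℓ x) :
    L (approxInvSens U L x t).toNat x ≤ t ∧ t ≤ U (approxInvSens U L x t).toNat x := by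
  have hne : {k : ℕ | L k x ≤ t ∧ t ≤ U k x}.Nonempty := ⟨ℓ, hL, hU⟩
  obtain ⟨k, hk, hk'⟩ := csInf_mem (hne.image fun k : ℕ => (k : ℕ∞))
  have h : approxInvSens U L x t = k := hk'.symm
  rw [h, ENat.toNat_natCast]
  exact hk

/-- For bounded `f` and approximate upper and lower sensitivity bounding functions,
for neighboring `x, x'` and `inf f ≤ t ≤ sup f`,
`|Ψ̄_f(x;t) − Ψ̄_f(x';t)| ≤ 1`. -/
theorem stmt5 {n : ℕ} {X : Type*} (f : (Fin n → X) → ℝ)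
    (hbdd : BddAbove (Set.range f) ∧ BddBelow (Set.range f))
    (U L : ℕ → (Fin n → X) → ℝ)
    (hU1 : ∀ (ℓ : ℕ) (x : Fin n → X), upperBd f x ℓ ≤ U ℓ x)
    (hU2 : ∀ (ℓ : ℕ) (x x' : Fin n → X), hdist x x' ≤ 1 → U ℓ x ≤ U (ℓ + 1) x')
    (hL1 : ∀ (ℓ : ℕ) (x : Fin n → X), L ℓ x ≤ lowerBd f x ℓ)
    (hL2 : ∀ (ℓ : ℕ) (x x' : Fin n → X), hdist x x' ≤ 1 → L (ℓ + 1) x' ≤ L ℓ x)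
    (x x' : Fin n → X) (hnb : hdist x x' ≤ 1) (t : ℝ)
    (htl : sInf (Set.range f) ≤ t) (htu : t ≤ sSup (Set.range f)) :
    |approxReflSens f U L x t - approxReflSens f U L x' t| ≤ 1 := by
  have hnb' : hdist x' x ≤ 1 := hdist_comm x x' ▸ hnb
  have hL_n (y : Fin n → X) : L n y ≤ t :=
    (hL1 n y).trans (by rwa [lowerBd, image_setOf_hdist_le_self])
  have hU_n (y : Fin n → X) : t ≤ U n y :=
    le_trans (by rwa [upperBd, image_setOf_hdist_le_self]) (hU1 n y)
  have hstep (y z : Fin n → X) (h : hdist y z ≤ 1) :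
      (approxInvSens U L z t).toNat ≤ (approxInvSens U L y t).toNat + 1 := by
    obtain ⟨hl, hu⟩ := toNat_approxInvSens_mem (hL_n y) (hU_n y)
    exact toNat_approxInvSens_le ((hL2 _ y z h).trans hl) (hu.trans (hU2 _ y z h))
  have hone (y a b : Fin n → X) (ha : hdist y a ≤ 1) (hb : hdist y b ≤ 1) (hat : f a ≤ t)
      (htb : t ≤ f b) : (approxInvSens U L y t).toNat ≤ 1 :=
    toNat_approxInvSens_le ((hL1 1 y).trans ((lowerBd_le hbdd.2 ha).trans hat))
      ((htb.trans (le_upperBd hbdd.1 hb)).trans (hU1 1 y))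
  have hx : hdist x x ≤ 1 := by simp [hdist_self]
  have hx' : hdist x' x' ≤ 1 := by simp [hdist_self]
  have h₁ := hstep x x' hnb
  have h₂ := hstep x' x hnb'
  have h₃ := hone x x x' hx hnb
  have h₄ := hone x x' x hnb hx
  have h₅ := hone x' x x' hnb' hx'
  have h₆ := hone x' x' x hx' hnb'
  unfold approxReflSens
  generalize (approxInvSens U L x t).toNat = a at *
  generalize (approxInvSens U L x' t).toNat = b at *
  have ha : (0 : ℝ) ≤ a := a.cast_nonneg
  have hb : (0 : ℝ) ≤ b := b.cast_nonneg
  rify at h₁ h₂ h₃ h₄ h₅ h₆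
  rw [abs_le]
  rcases lt_trichotomy (f x) t with h | h | h <;> rcases lt_trichotomy (f x') t with h' | h' | h' <;>
    simp only [Real.sign_of_pos, Real.sign_of_neg, Real.sign_zero, sub_pos, sub_neg, h, h',
      sub_self] <;>
    first
      | constructor <;> linarith
      | have := h₃ h.le h'.le; have := h₅ h.le h'.le; constructor <;> linarith
      | have := h₄ h'.le h.le; have := h₆ h'.le h.le; constructor <;> linarith
      | have := h₃ h.le h'.ge; have := h₅ h.le h'.ge; constructor <;> linarith
      | have := h₄ h'.le h.ge; have := h₆ h'.le h.ge; constructor <;> linarith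
end

section
/- Let a ≤ b be reals, n ≥ 1, ℓ ∈ ℕ, and let x, x' ∈ [a,b]^n with Hamming distance d_ham(x,x') ≤ ℓ. Then Var(x') ≤ Var(x) + ℓ·(b−a)²/n. -/
open scoped Classical

/-- The mean of the coordinates of `x` indexed by `s`. -/
noncomputable def meanOn {n : ℕ} (s : Finset (Fin n)) (x : Fin n → ℝ) : ℝ :=
  (∑ i ∈ s, x i) / s.card

/-- The variance of the tuple of coordinates of `x` indexed by `s`. -/
noncomputable def varOn {n : ℕ} (s : Finset (Fin n)) (x : Fin n → ℝ) : ℝ :=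
  (∑ i ∈ s, (x i - meanOn s x) ^ 2) / s.card

/-- The variance of a dataset `x ∈ ℝ^n`. -/
noncomputable def Var {n : ℕ} (x : Fin n → ℝ) : ℝ :=
  varOn Finset.univ x

/-- The mean minimizes the sum of squared deviations. -/
theorem sum_sq_sub_meanOn_le {n : ℕ} {s : Finset (Fin n)} (hs : s.Nonempty)
    (y : Fin n → ℝ) (c : ℝ) :
    ∑ i ∈ s, (y i - meanOn s y) ^ 2 ≤ ∑ i ∈ s, (y i - c) ^ 2 := by
  have hcard : (s.card : ℝ) ≠ 0 := by exact_mod_cast hs.card_pos.ne'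
  have hsum : ∑ i ∈ s, y i = s.card * meanOn s y := by
    unfold meanOn
    field_simp
  have key : ∑ i ∈ s, (y i - c) ^ 2 =
      ∑ i ∈ s, (y i - meanOn s y) ^ 2 + s.card * (meanOn s y - c) ^ 2 := by
    have h : ∀ i ∈ s, (y i - c) ^ 2 = (y i - meanOn s y) ^ 2 +
        (2 * (meanOn s y - c) * y i + (c ^ 2 - meanOn s y ^ 2)) := fun i _ => by ring
    rw [Finset.sum_congr rfl h, Finset.sum_add_distrib, Finset.sum_add_distrib,
      ← Finset.mul_sum, hsum, Finset.sum_const, nsmul_eq_mul]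
    ring
  rw [key]
  exact le_add_of_nonneg_right (by positivity)

/-- The mean of points of `[a,b]` lies in `[a,b]`. -/
theorem meanOn_mem_Icc {n : ℕ} {s : Finset (Fin n)} (hs : s.Nonempty) {a b : ℝ}
    {x : Fin n → ℝ} (hx : ∀ i ∈ s, x i ∈ Set.Icc a b) : meanOn s x ∈ Set.Icc a b := by
  have hcard : (0 : ℝ) < s.card := by exact_mod_cast hs.card_pos
  have hlo := Finset.card_nsmul_le_sum s x a fun i hi => (hx i hi).1
  have hhi := Finset.sum_le_card_nsmul s x b fun i hi => (hx i hi).2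
  rw [nsmul_eq_mul] at hlo hhi
  constructor
  · rw [meanOn, le_div_iff₀ hcard]
    linarith
  · rw [meanOn, div_le_iff₀ hcard]
    linarith

/-- For datasets in `[a,b]^n` at Hamming distance at most `ℓ`,
`Var(x') ≤ Var(x) + ℓ·(b−a)²/n`. -/
theorem stmt9 {n : ℕ} (hn : 1 ≤ n) (a b : ℝ) (hab : a ≤ b) (ℓ : ℕ)
    (x x' : Fin n → ℝ)
    (hx : ∀ i, x i ∈ Set.Icc a b) (hx' : ∀ i, x' i ∈ Set.Icc a b)
    (hd : hdist x x' ≤ ℓ) :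
    Var x' ≤ Var x + ℓ * (b - a) ^ 2 / n := by
  have hne : (Finset.univ : Finset (Fin n)).Nonempty := ⟨⟨0, hn⟩, Finset.mem_univ _⟩
  obtain ⟨hma, hmb⟩ := meanOn_mem_Icc hne fun i _ => hx i
  have hterm : ∀ i, (x' i - meanOn Finset.univ x) ^ 2 ≤
      (x i - meanOn Finset.univ x) ^ 2 + if x i ≠ x' i then (b - a) ^ 2 else 0 := by
    intro i
    split_ifs with h
    · have hle : (x' i - meanOn Finset.univ x) ^ 2 ≤ (b - a) ^ 2 :=
        sq_le_sq' (by linarith [(hx' i).1]) (by linarith [(hx' i).2])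
      linarith [sq_nonneg (x i - meanOn Finset.univ x)]
    · rw [not_not.mp h, add_zero]
  have hcount : ∑ i, (if x i ≠ x' i then (b - a) ^ 2 else 0) ≤ ℓ * (b - a) ^ 2 := by
    rw [← Finset.sum_filter, Finset.sum_const, nsmul_eq_mul]
    have hd' : (hdist x x' : ℝ) ≤ ℓ := by exact_mod_cast hd
    exact mul_le_mul_of_nonneg_right hd' (sq_nonneg _)
  have hsum := Finset.sum_le_sum fun i (_ : i ∈ Finset.univ) => hterm i
  rw [Finset.sum_add_distrib] at hsum
  have hmin := sum_sq_sub_meanOn_le hne x' (meanOn Finset.univ x)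
  rw [Var, Var, varOn, varOn, Finset.card_univ, Fintype.card_fin, ← add_div]
  gcongr
  linarith
end
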